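/- arXiv:1206.4825 — 2 statements merged into one kernel-verified Lean document; each statement's English description precedes it below -/
import Mathlib

section
/- For every finite simple graph G with at least one vertex, the vertex set V(G) can be covered by at most α(G) pairwise vertex-disjoint paths of G, where α(G) is the independence number of G. -/
/-- The independence number of `G`: the maximum cardinality of a set of pairwise
nonadjacent vertices. -/
noncomputable def indepNum {V : Type*} (G : SimpleGraph V) : ℕ :=
  sSup {n : ℕ | ∃ S : Set V, (∀ a ∈ S, ∀ b ∈ S, ¬ G.Adj a b) ∧ S.ncard = n}

/-- A list of walks, given by their nonempty vertex lists, can be concatenated end to end until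
the initial vertices of the walks are pairwise nonadjacent. -/
theorem exists_flatten_perm_pairwise_not_adj_head {V : Type*} (G : SimpleGraph V)
    (L : List (List V)) (hL : ∀ l ∈ L, l ≠ [] ∧ l.IsChain G.Adj) :
    ∃ M : List (List V), (∀ l ∈ M, l ≠ [] ∧ l.IsChain G.Adj) ∧ M.flatten.Perm L.flatten ∧
      M.Pairwise fun l m => ∀ x ∈ l.head?, ∀ y ∈ m.head?, ¬ G.Adj x y := by
  induction hn : L.length using Nat.strong_induction_on generalizing L with
  | _ n ih =>
  by_cases h : L.Pairwise fun l m => ∀ x ∈ l.head?, ∀ y ∈ m.head?, ¬ G.Adj x y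
  · exact ⟨L, hL, .refl _, h⟩
  rw [List.pairwise_iff_forall_sublist] at h
  push Not at h
  obtain ⟨l, m, hs, x, hx, y, hy, hxy⟩ := h
  obtain ⟨K, hK⟩ := hs.exists_perm_append
  have hl := hL l (hK.mem_iff.2 (by simp))
  have hm := hL m (hK.mem_iff.2 (by simp))
  obtain ⟨M, hM, hMp, hMh⟩ := ih (((l.reverse ++ m) :: K).length)
    (by have := hK.length_eq; simp at this ⊢; omega) ((l.reverse ++ m) :: K) (by
      intro k hk
      rcases List.mem_cons.1 hk with rfl | hk
      · refine ⟨by simp [hm.1], List.IsChain.append ?_ hm.2 ?_⟩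
        · simpa [List.isChain_reverse, G.adj_comm] using hl.2
        · intro a ha b hb
          rw [List.getLast?_reverse] at ha
          rwa [Option.mem_unique ha hx, Option.mem_unique hb hy]
      · exact hL k (hK.mem_iff.2 (by simp [hk]))) rfl
  refine ⟨M, hM, hMp.trans (.trans ?_ hK.flatten.symm), hMh⟩
  simpa using (List.reverse_perm l).append_right (m ++ K.flatten)

/-- In a finite graph, any set of pairwise nonadjacent vertices has at most `indepNum G`
elements. -/
theorem ncard_le_indepNum {V : Type*} [Finite V] (G : SimpleGraph V) (S : Set V)
    (hS : ∀ a ∈ S, ∀ b ∈ S, ¬ G.Adj a b) : S.ncard ≤ indepNum G := by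
  refine le_csSup ⟨Nat.card V, ?_⟩ ⟨S, hS, rfl⟩
  rintro _ ⟨T, -, rfl⟩
  exact Set.ncard_le_card T

/-- **Theorem (statement 4).** The vertex set of any finite graph `G` with at least one
vertex can be covered by at most `α(G)` pairwise vertex-disjoint paths of `G`. -/
theorem vertex_set_covered_by_indepNum_paths
    {V : Type*} [Fintype V] [Nonempty V] (G : SimpleGraph V) :
    ∃ (k : ℕ) (a b : Fin k → V) (p : ∀ i : Fin k, G.Walk (a i) (b i)),
      k ≤ indepNum G ∧
      (∀ i, (p i).IsPath) ∧
      (∀ i j, i ≠ j → ∀ v : V, v ∈ (p i).support → v ∉ (p j).support) ∧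
      (∀ v : V, ∃ i, v ∈ (p i).support) := by
  classical
  obtain ⟨M, hM, hp, hh⟩ := exists_flatten_perm_pairwise_not_adj_head G
    (Finset.univ.toList.map fun v : V => [v]) (by simp)
  have hflat : (Finset.univ.toList.map fun v : V => [v]).flatten = Finset.univ.toList := by
    simp [← List.flatMap_def]
  rw [hflat] at hp
  obtain ⟨hnd, hdisj⟩ := List.nodup_flatten.1 (hp.nodup_iff.2 (Finset.nodup_toList _))
  have hMi (i : Fin M.length) := hM M[i] (List.getElem_mem _)
  have hd (i j : Fin M.length) (hij : i ≠ j) (v : V) (hv : v ∈ M[i]) : v ∉ M[j] := by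
    intro hv'
    rw [List.pairwise_iff_getElem] at hdisj
    rcases lt_or_gt_of_ne hij with h | h
    · exact hdisj i j i.2 j.2 h hv hv'
    · exact hdisj j i j.2 i.2 h hv' hv
  refine ⟨M.length, fun i => M[i].head (hMi i).1, fun i => M[i].getLast (hMi i).1,
    fun i => .ofSupport M[i] (hMi i).1 (hMi i).2, ?_, ?_, ?_, ?_⟩
  · have hinj : Function.Injective fun i : Fin M.length => M[i].head (hMi i).1 := by
      intro i j hij
      by_contra hne
      refine hd i j hne _ (List.head_mem (hMi i).1) ?_
      simp only at hij
      rw [hij]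
      exact List.head_mem _
    have hcard := Set.ncard_range_of_injective hinj
    rw [Nat.card_fin] at hcard
    rw [← hcard]
    refine ncard_le_indepNum G _ ?_
    rintro _ ⟨i, rfl⟩ _ ⟨j, rfl⟩ hadj
    rw [List.pairwise_iff_getElem] at hh
    rcases lt_trichotomy i j with h | rfl | h
    · exact hh i j i.2 j.2 h _ (List.head_mem_head? (hMi i).1) _
        (List.head_mem_head? (hMi j).1) hadj
    · exact hadj.ne rfl
    · exact hh j i j.2 i.2 h _ (List.head_mem_head? (hMi j).1) _
        (List.head_mem_head? (hMi i).1) hadj.symm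
  · intro i
    rw [SimpleGraph.Walk.isPath_def, SimpleGraph.Walk.support_ofSupport]
    exact hnd _ (List.getElem_mem _)
  · simpa only [SimpleGraph.Walk.support_ofSupport] using hd
  · intro v
    obtain ⟨l, hl, hv⟩ := List.mem_flatten.1 (hp.mem_iff.2 (Finset.mem_toList.2 (Finset.mem_univ v)))
    obtain ⟨i, hi, rfl⟩ := List.getElem_of_mem hl
    exact ⟨⟨i, hi⟩, by simpa using hv⟩
end

section
/- Let s be a positive integer and let G be a connected simple graph such that every induced subgraph of G isomorphic to S(K_{1,2s+1}) has at least three of its edges in a block of G of degree at most two. Let x be a cut vertex of G, let B be the union of one or more branches of G at x, and let xyz be an induced path of G on three vertices such that y and z lie in a branch of G at x which is not contained in B. Then the induced subgraph G' = G[V(B) ∪ {y, z}] also has the property that every induced subgraph of G' isomorphic to S(K_{1,2s+1}) has at least three of its edges in a block of G' of degree at most two. -/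
/-- The graph `S(K_{1,n})` obtained from the star `K_{1,n}` by subdividing every edge
once: the center is `none`, the subdivision vertices are `some (i, false)` and the
leaves are `some (i, true)`. -/
def subdividedStar (n : ℕ) : SimpleGraph (Option (Fin n × Bool)) :=
  SimpleGraph.fromRel (fun a b =>
    (a = none ∧ ∃ i : Fin n, b = some (i, false)) ∨
    (∃ i : Fin n, a = some (i, false) ∧ b = some (i, true)))

/-- `v` is a cut vertex of `G`: there are two vertices distinct from `v` that are
connected in `G` but no longer connected after deleting `v`. -/
def SimpleGraph.IsCutVertex {V : Type*} (G : SimpleGraph V) (v : V) : Prop :=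
  ∃ a b : ({u | u ≠ v} : Set V),
    G.Reachable a b ∧ ¬ (G.induce {u | u ≠ v}).Reachable a b

/-- `B` is (the vertex set of) a block of `G`: a maximal subgraph of `G` that is
connected and has no cut vertex. -/
def SimpleGraph.IsBlockSet {V : Type*} (G : SimpleGraph V) (B : Set V) : Prop :=
  (G.induce B).Connected ∧ (∀ v, ¬ (G.induce B).IsCutVertex v) ∧
    ∀ C : Set V, B ⊆ C → (G.induce C).Connected →
      (∀ v, ¬ (G.induce C).IsCutVertex v) → B = C

/-- The degree of a block `B` of `G`: the number of cut vertices of `G` in `B`. -/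
noncomputable def SimpleGraph.blockDegree {V : Type*} (G : SimpleGraph V) (B : Set V) : ℕ :=
  {v ∈ B | G.IsCutVertex v}.ncard

/-- Every induced copy of `S(K_{1,2s+1})` in `G` has at least three edges contained in
a single block of `G` of degree at most two. -/
def GoodProperty {V : Type*} (s : ℕ) (G : SimpleGraph V) : Prop :=
  ∀ f : subdividedStar (2 * s + 1) ↪g G,
    ∃ B : Set V, G.IsBlockSet B ∧ G.blockDegree B ≤ 2 ∧
      3 ≤ {e ∈ (subdividedStar (2 * s + 1)).edgeSet | ∀ w ∈ e, f w ∈ B}.ncard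

/-- A map sending adjacent vertices to reachable ones preserves reachability. -/
theorem SimpleGraph.Reachable.map_of_adj {V W : Type*} {G : SimpleGraph V} {H : SimpleGraph W}
    (φ : V → W) (hφ : ∀ u w, G.Adj u w → H.Reachable (φ u) (φ w)) {a b : V}
    (h : G.Reachable a b) : H.Reachable (φ a) (φ b) := by
  obtain ⟨p⟩ := h
  induction p with
  | nil => exact .refl _
  | cons hadj _ ih => exact (hφ _ _ hadj).trans ih

theorem SimpleGraph.IsCutVertex.map_iso {V W : Type*} {G : SimpleGraph V} {H : SimpleGraph W}
    (e : G ≃g H) {v : V} (h : G.IsCutVertex v) : H.IsCutVertex (e v) := by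
  obtain ⟨a, b, hab, hnot⟩ := h
  refine ⟨⟨e a, fun h => a.2 (e.injective h)⟩, ⟨e b, fun h => b.2 (e.injective h)⟩,
    hab.map e.toHom, fun hr => hnot ?_⟩
  have hmaps : Set.MapsTo e.symm.toHom {u | u ≠ e v} {u | u ≠ v} := by
    intro u hu huv
    exact hu (by rw [← huv]; exact (e.apply_symm_apply u).symm)
  have := hr.map (SimpleGraph.induceHom e.symm.toHom hmaps)
  convert this using 1 <;> ext <;> exact (e.symm_apply_apply _).symm

/-- Inducing twice is inducing on the image. -/
noncomputable def SimpleGraph.induceInduceIso {V : Type*} (G : SimpleGraph V) (T : Set V)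
    (C : Set T) : (G.induce T).induce C ≃g G.induce (Subtype.val '' C) where
  toEquiv := Equiv.Set.image _ C Subtype.val_injective
  map_rel_iff' := Iff.rfl

/-- A set inducing a connected graph without cut vertices lies on one side of the vertex `x`. -/
theorem SimpleGraph.subset_or_inter_subset_of_forall_not_isCutVertex {V : Type*}
    {G : SimpleGraph V} {x : V} {S B : Set V}
    (hS : ∀ (v w : V) (_ : v ∈ S) (hvx : v ≠ x) (hwx : w ≠ x),
      (G.induce {u | u ≠ x}).Reachable ⟨v, hvx⟩ ⟨w, hwx⟩ → w ∈ S)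
    (hxS : x ∈ S) (hB : (G.induce B).Connected) (hcut : ∀ v, ¬ (G.induce B).IsCutVertex v) :
    B ⊆ S ∨ B ∩ S ⊆ {x} := by
  by_contra! hcon
  obtain ⟨hBS, hBx⟩ := hcon
  obtain ⟨b, hb, hbS⟩ := Set.not_subset.1 hBS
  obtain ⟨a, ⟨ha, haS⟩, hax⟩ := Set.not_subset.1 hBx
  replace hax : a ≠ x := hax
  have hbx : b ≠ x := fun h => hbS (h ▸ hxS)
  refine hbS (hS a b haS hax hbx ?_)
  have hr := hB.preconnected ⟨a, ha⟩ ⟨b, hb⟩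
  by_cases hx : x ∈ B
  · have hr' : ((G.induce B).induce {u | u ≠ ⟨x, hx⟩}).Reachable
        ⟨⟨a, ha⟩, fun h => hax (congrArg Subtype.val h)⟩
        ⟨⟨b, hb⟩, fun h => hbx (congrArg Subtype.val h)⟩ := by
      by_contra hn
      exact hcut ⟨x, hx⟩ ⟨_, _, hr, hn⟩
    have hmaps : Set.MapsTo (SimpleGraph.Embedding.induce (G := G) B).toHom
        {u | u ≠ ⟨x, hx⟩} {u | u ≠ x} :=
      fun u hu h => hu (Subtype.ext h)
    exact hr'.map (SimpleGraph.induceHom _ hmaps)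
  · have hBx' : B ⊆ {u | u ≠ x} := fun u hu h => hx (h ▸ hu)
    exact hr.map (SimpleGraph.induceHomOfLE G hBx').toHom

/-- A block contained in `T` is a block of the subgraph induced by `T`. -/
theorem SimpleGraph.IsBlockSet.preimage_val {V : Type*} {G : SimpleGraph V} {B T : Set V}
    (h : G.IsBlockSet B) (hBT : B ⊆ T) :
    (G.induce T).IsBlockSet (Subtype.val ⁻¹' B) := by
  obtain ⟨hB, hcut, hmax⟩ := h
  have him : Subtype.val '' (Subtype.val ⁻¹' B : Set T) = B := by
    rw [Subtype.image_preimage_coe, Set.inter_eq_right.2 hBT]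
  have e := G.induceInduceIso T (Subtype.val ⁻¹' B)
  rw [him] at e
  refine ⟨e.connected_iff.2 hB, fun v hv => hcut _ (hv.map_iso e), fun C hBC hC hCcut => ?_⟩
  have eC := G.induceInduceIso T C
  have := hmax (Subtype.val '' C) (him ▸ Set.image_mono hBC) (eC.connected_iff.1 hC)
    fun v hv => hCcut _ (hv.map_iso eC.symm)
  rw [this, Set.preimage_image_eq _ Subtype.val_injective]

/-- Cut vertices, other than `x`, of a union of branches at `x` with a pendant path attached to
`x` are cut vertices of the whole graph. -/
theorem SimpleGraph.IsCutVertex.of_induce_branches_union_path {V : Type*} {G : SimpleGraph V}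
    {x : V} {S : Set V} (hxS : x ∈ S)
    (hS : ∀ (v w : V) (_ : v ∈ S) (hvx : v ≠ x) (hwx : w ≠ x),
      (G.induce {u | u ≠ x}).Reachable ⟨v, hvx⟩ ⟨w, hwx⟩ → w ∈ S)
    {y z : V} (hxy : G.Adj x y) (hyz : G.Adj y z) (hyS : y ∉ S) (hzS : z ∉ S)
    {v : (S ∪ {y, z} : Set V)} (hvS : (v : V) ∈ S) (hvx : (v : V) ≠ x)
    (h : (G.induce (S ∪ {y, z})).IsCutVertex v) : G.IsCutVertex v := by
  classical
  obtain ⟨a, b, hab, hnot⟩ := h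
  refine ⟨⟨a, fun h => a.2 (Subtype.ext h)⟩, ⟨b, fun h => b.2 (Subtype.ext h)⟩,
    hab.map (SimpleGraph.Embedding.induce _).toHom, fun hr => hnot ?_⟩
  have hyv : y ≠ v := fun h => hyS (h ▸ hvS)
  have hzv : z ≠ v := fun h => hzS (h ▸ hvS)
  have hboundary : ∀ u w, G.Adj u w → u ∈ S → w ∉ S → u = x := by
    intro u w huw hu hw
    by_contra hux
    have hwx : w ≠ x := fun h => hw (h ▸ hxS)
    exact hw (hS u w hu hux hwx (SimpleGraph.Adj.reachable (by simpa using huw)))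
  let H := (G.induce (S ∪ {y, z})).induce {u | u ≠ v}
  let x' : {u : (S ∪ {y, z} : Set V) | u ≠ v} :=
    ⟨⟨x, Or.inl hxS⟩, fun h => hvx (congrArg Subtype.val h).symm⟩
  let φ : {u : V | u ≠ v} → {u : (S ∪ {y, z} : Set V) | u ≠ v} := fun u =>
    if hu : (u : V) ∈ S then ⟨⟨u, Or.inl hu⟩, fun h => u.2 (congrArg Subtype.val h)⟩ else x'
  have hφ : ∀ u w, (G.induce {u : V | u ≠ v}).Adj u w → H.Reachable (φ u) (φ w) := by
    intro u w huw
    have huw' : G.Adj u w := huw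
    by_cases hu : (u : V) ∈ S <;> by_cases hw : (w : V) ∈ S
    · refine SimpleGraph.Adj.reachable ?_
      simpa [H, φ, hu, hw] using huw'
    · have : φ u = φ w := by
        ext; simp [φ, hw, x', hboundary u w huw' hu hw, hxS]
      rw [this]
    · have : φ u = φ w := by
        ext; simp [φ, hu, x', hboundary w u huw'.symm hw hu, hxS]
      rw [this]
    · have : φ u = φ w := by simp [φ, hu, hw]
      rw [this]
  have hretract : ∀ (c : {u : (S ∪ {y, z} : Set V) | u ≠ v})
      (hc : ((c : (S ∪ {y, z} : Set V)) : V) ≠ v), H.Reachable c (φ ⟨c, hc⟩) := by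
    rintro ⟨⟨c, hcT⟩, hcv⟩ hc
    by_cases hcS : c ∈ S
    · simp [φ, hcS]
    · have hy : H.Reachable ⟨⟨y, by simp⟩, fun h => hyv (congrArg Subtype.val h)⟩ x' :=
        SimpleGraph.Adj.reachable (show G.Adj y x from hxy.symm)
      have hz : H.Reachable ⟨⟨z, by simp⟩, fun h => hzv (congrArg Subtype.val h)⟩
          ⟨⟨y, by simp⟩, fun h => hyv (congrArg Subtype.val h)⟩ :=
        SimpleGraph.Adj.reachable (show G.Adj z y from hyz.symm)
      have hφc : φ ⟨c, hc⟩ = x' := by simp [φ, hcS]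
      change H.Reachable _ (φ ⟨c, hc⟩)
      rw [hφc]
      rcases hcT with hcT | rfl | rfl
      · exact absurd hcT hcS
      · exact hy
      · exact hz.trans hy
  exact (hretract a _).trans ((hr.map_of_adj φ hφ).trans (hretract b _).symm)

/-- **Claim (statement 7).** Let `G` be connected with the good property, let `x` be
a cut vertex of `G`, let `S` be the (vertex set of the) union of one or more branches
of `G` at `x` (i.e. `x ∈ S`, `S \ {x}` is nonempty and is a union of connected
components of `G - x`), and let `x y z` be an induced path of `G` with `y, z` lying
in a branch of `G` at `x` not contained in `S`. Then the induced subgraph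
`G' = G[S ∪ {y, z}]` also has the good property. -/
theorem goodProperty_of_branches_with_path
    {V : Type*} [Fintype V] (s : ℕ) (hs : 0 < s) (G : SimpleGraph V)
    (hconn : G.Connected) (hgood : GoodProperty s G)
    (x : V) (hcut : G.IsCutVertex x)
    (S : Set V) (hxS : x ∈ S) (hSne : (S \ {x}).Nonempty)
    (hSbranches : ∀ (v w : V) (hv : v ∈ S) (hvx : v ≠ x) (hwx : w ≠ x),
      (G.induce {u | u ≠ x}).Reachable ⟨v, hvx⟩ ⟨w, hwx⟩ → w ∈ S)
    (y z : V) (hxy : G.Adj x y) (hyz : G.Adj y z) (hxz : ¬ G.Adj x z) (hxzne : x ≠ z)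
    (hyS : y ∉ S) (hzS : z ∉ S) :
    GoodProperty s (G.induce (S ∪ {y, z})) := by
  intro f
  obtain ⟨B, hB, hdeg, hedges⟩ :=
    hgood (f.trans (SimpleGraph.Embedding.induce (S ∪ {y, z})))
  rcases SimpleGraph.subset_or_inter_subset_of_forall_not_isCutVertex hSbranches hxS hB.1 hB.2.1
    with hBS | hBx
  · refine ⟨Subtype.val ⁻¹' B, hB.preimage_val (hBS.trans Set.subset_union_left), ?_, hedges⟩
    refine le_trans (Set.ncard_le_ncard_of_injOn Subtype.val ?_
      Subtype.val_injective.injOn (Set.toFinite _)) hdeg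
    rintro v ⟨hvB, hv⟩
    refine ⟨hvB, ?_⟩
    by_cases hvx : (v : V) = x
    · exact hvx ▸ hcut
    · exact hv.of_induce_branches_union_path hxS hSbranches hxy hyz hyS hzS (hBS hvB) hvx
  · exfalso
    have hT : ∀ w, (f w : V) ∈ B → (f w : V) = x ∨ (f w : V) = y ∨ (f w : V) = z := by
      intro w hw
      rcases (f w).2 with h | h
      · exact Or.inl (hBx ⟨hw, h⟩)
      · exact Or.inr h
    have hle := Set.ncard_le_ncard_of_injOn (t := ({s(x, y), s(y, z)} : Set (Sym2 V)))
      (Sym2.map fun w => (f w : V)) ?_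
      (Sym2.map.injective (Subtype.val_injective.comp f.injective)).injOn (Set.toFinite _)
      (s := {e ∈ (subdividedStar (2 * s + 1)).edgeSet | ∀ w ∈ e, (f w : V) ∈ B})
    · have h2 := hle.trans (Set.ncard_insert_le _ _)
      rw [Set.ncard_singleton] at h2
      exact absurd (le_trans hedges h2) (by norm_num)
    · rintro e ⟨he, heB⟩
      induction e with
      | h u w =>
        have hadj : G.Adj (f u) (f w) := f.map_rel_iff.2 he
        have hu := hT u (heB u (by simp))
        have hw := hT w (heB w (by simp))
        have hzx : ¬ G.Adj z x := fun h => hxz h.symm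
        rw [Sym2.map_mk]
        rcases hu with hu | hu | hu <;> rcases hw with hw | hw | hw <;>
          simp_all
end
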